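/- arXiv:1108.3416 — 5 statements merged into one kernel-verified Lean document; each statement's English description precedes it below -/
import Mathlib

section
/- Fix τ > 0, a ≠ 0, an integer ℓ with |ℓ| ≥ 1, and β₀ > 0. There exist constants M₀ > 0 and ν₀ > 0 such that for all ν ∈ (0, ν₀), all t ∈ [0, τ/ν], and all u ∈ H¹(𝕋; ℂ): (1/8)‖∂_x u‖² + (β₀/(2ν)) ‖C^ℓ(t) u‖² ≥ (M₀ |ℓ| √β₀ / √ν) ‖u‖². -/
/- Multiplication operator `C^ℓ(t) u = -i a ℓ e^{-νt} cos(x) u` on functions on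
   the torus 𝕋 = ℝ/2πℤ, modeled as `2π`-periodic functions `ℝ → ℂ`. -/
noncomputable def Cop (a ν t : ℝ) (ℓ : ℤ) (u : ℝ → ℂ) : ℝ → ℂ :=
  fun x => (-Complex.I) * (a : ℂ) * (ℓ : ℂ) * (Real.exp (-(ν * t)) : ℂ) *
    (Real.cos x : ℂ) * u x

/- L² squared norm on the torus. -/
noncomputable def tnormSq (f : ℝ → ℂ) : ℝ :=
  ∫ x in (0:ℝ)..(2 * Real.pi), ‖f x‖ ^ 2

open MeasureTheory in
theorem key_ineq (μ P : ℝ) (hP : 2 * μ + μ ^ 2 ≤ P) (u : ℝ → ℂ) (hu : ContDiff ℝ 1 u)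
    (hper : Function.Periodic u (2 * Real.pi)) :
    μ * tnormSq u ≤ tnormSq (deriv u) +
      P * ∫ x in (0:ℝ)..(2 * Real.pi), Real.cos x ^ 2 * ‖u x‖ ^ 2 := by
  have hc : Continuous u := hu.continuous
  have hc' : Continuous (deriv u) := hu.continuous_deriv le_rfl
  have hd : ∀ x, HasDerivAt u (deriv u x) x :=
    fun x => ((hu.differentiable one_ne_zero) x).hasDerivAt
  have hg : ∀ x, HasDerivAt (fun x => μ * (Real.sin x * Real.cos x) * ‖u x‖ ^ 2)
      (μ * (Real.cos x * Real.cos x + Real.sin x * (-Real.sin x)) * ‖u x‖ ^ 2 +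
        μ * (Real.sin x * Real.cos x) * (2 * inner ℝ (u x) (deriv u x))) x := by
    intro x
    exact ((((Real.hasDerivAt_sin x).mul (Real.hasDerivAt_cos x)).const_mul μ).mul
      (hd x).norm_sq)
  have hint := intervalIntegral.integral_eq_sub_of_hasDerivAt (a := 0) (b := 2 * Real.pi)
    (fun x _ => hg x) (Continuous.intervalIntegrable (by fun_prop) _ _)
  have hi1 : IntervalIntegrable (fun x => ‖deriv u x‖ ^ 2) volume 0 (2 * Real.pi) :=
    Continuous.intervalIntegrable (by fun_prop) _ _
  have hi2 : IntervalIntegrable (fun x => P * (Real.cos x ^ 2 * ‖u x‖ ^ 2)) volume 0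
    (2 * Real.pi) := Continuous.intervalIntegrable (by fun_prop) _ _
  have hi3 : IntervalIntegrable (fun x => μ * ‖u x‖ ^ 2) volume 0 (2 * Real.pi) :=
    Continuous.intervalIntegrable (by fun_prop) _ _
  have hmono := intervalIntegral.integral_mono_on (a := 0) (b := 2 * Real.pi) (μ := volume)
    (f := fun x => μ * (Real.cos x * Real.cos x + Real.sin x * (-Real.sin x)) * ‖u x‖ ^ 2 +
        μ * (Real.sin x * Real.cos x) * (2 * inner ℝ (u x) (deriv u x)))
    (g := fun x => ‖deriv u x‖ ^ 2 + P * (Real.cos x ^ 2 * ‖u x‖ ^ 2) - μ * ‖u x‖ ^ 2)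
    (by positivity) (Continuous.intervalIntegrable (by fun_prop) _ _)
    ((hi1.add hi2).sub hi3) (by
      intro x _
      have h1 := norm_sub_sq_real (deriv u x) ((μ * (Real.sin x * Real.cos x)) • u x)
      rw [norm_smul, inner_smul_right, mul_pow, Real.norm_eq_abs, sq_abs,
        real_inner_comm] at h1
      have h2 := sq_nonneg ‖deriv u x - (μ * (Real.sin x * Real.cos x)) • u x‖
      have h3 := Real.sin_sq_add_cos_sq x
      have h4 : 0 ≤ (P - (2 * μ + μ ^ 2)) * (Real.cos x ^ 2 * ‖u x‖ ^ 2) :=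
        mul_nonneg (by linarith) (by positivity)
      have h5 : 0 ≤ μ ^ 2 * (Real.cos x ^ 2) ^ 2 * ‖u x‖ ^ 2 := by positivity
      have h6 : Real.sin x ^ 2 = 1 - Real.cos x ^ 2 := by linarith
      have h7 : (μ * (Real.sin x * Real.cos x)) ^ 2 * ‖u x‖ ^ 2
        = μ ^ 2 * (1 - Real.cos x ^ 2) * Real.cos x ^ 2 * ‖u x‖ ^ 2 := by
        rw [← h6]; ring
      have h8 : μ * (Real.cos x * Real.cos x + Real.sin x * (-Real.sin x)) * ‖u x‖ ^ 2
        = μ * (2 * Real.cos x ^ 2 - 1) * ‖u x‖ ^ 2 := by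
        have : Real.cos x * Real.cos x + Real.sin x * (-Real.sin x)
          = Real.cos x ^ 2 - Real.sin x ^ 2 := by ring
        rw [this, h6]; ring
      rw [h7] at h1
      rw [h8]
      nlinarith [h1, h2, h4, h5])
  rw [hint, intervalIntegral.integral_sub (hi1.add hi2) hi3,
    intervalIntegral.integral_add hi1 hi2, intervalIntegral.integral_const_mul,
    intervalIntegral.integral_const_mul] at hmono
  simp only [Real.sin_two_pi, Real.sin_zero, zero_mul, mul_zero, sub_zero] at hmono
  unfold tnormSq
  linarith

theorem tnormSq_Cop (a ν t : ℝ) (ℓ : ℤ) (u : ℝ → ℂ) :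
    tnormSq (Cop a ν t ℓ u) = (a * ℓ * Real.exp (-(ν * t))) ^ 2 *
      ∫ x in (0:ℝ)..(2 * Real.pi), Real.cos x ^ 2 * ‖u x‖ ^ 2 := by
  unfold tnormSq Cop
  rw [← intervalIntegral.integral_const_mul]
  congr 1
  funext x
  simp only [norm_mul, norm_neg, Complex.norm_I, Complex.norm_real, Complex.norm_intCast,
    Real.norm_eq_abs, mul_pow, sq_abs]
  ring

/-- Proposition 2.3 of the paper: for fixed `τ > 0`, `a ≠ 0`,
`|ℓ| ≥ 1`, `β₀ > 0`, there are `M₀, ν₀ > 0` such that for all `ν ∈ (0,ν₀)`,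
`t ∈ [0, τ/ν]` and `u ∈ H¹(𝕋;ℂ)`:
`(1/8)‖∂ₓu‖² + (β₀/(2ν))‖C^ℓ(t)u‖² ≥ (M₀|ℓ|√β₀/√ν)‖u‖²`. -/
theorem stmt2 (τ : ℝ) (hτ : 0 < τ) (a : ℝ) (ha : a ≠ 0) (ℓ : ℤ) (hℓ : 1 ≤ |ℓ|)
    (β₀ : ℝ) (hβ₀ : 0 < β₀) :
    ∃ M₀ ν₀ : ℝ, 0 < M₀ ∧ 0 < ν₀ ∧
      ∀ ν : ℝ, 0 < ν → ν < ν₀ →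
        ∀ t : ℝ, 0 ≤ t → t ≤ τ / ν →
          ∀ u : ℝ → ℂ, ContDiff ℝ 1 u → Function.Periodic u (2 * Real.pi) →
            (1 / 8) * tnormSq (deriv u) + (β₀ / (2 * ν)) * tnormSq (Cop a ν t ℓ u) ≥
              (M₀ * |(ℓ : ℝ)| * Real.sqrt β₀ / Real.sqrt ν) * tnormSq u := by
  have hl : (1:ℝ) ≤ |(ℓ:ℝ)| := by exact_mod_cast hℓ
  have hc : 0 < |a| * Real.exp (-τ) / 2 := by positivity
  obtain ⟨c, hcd⟩ : ∃ c, c = |a| * Real.exp (-τ) / 2 := ⟨_, rfl⟩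
  rw [← hcd] at hc
  refine ⟨c / 8, c ^ 2 * β₀, by positivity, by positivity, ?_⟩
  intro ν hν hν0 t ht htt u hu hper
  have hs : 0 < Real.sqrt ν := Real.sqrt_pos.2 hν
  have hνt : ν * t ≤ τ := by
    rw [le_div_iff₀ hν] at htt; linarith
  obtain ⟨μ, hμ⟩ : ∃ μ, μ = c * |(ℓ:ℝ)| * Real.sqrt β₀ / Real.sqrt ν := ⟨_, rfl⟩
  have hμ2 : μ ^ 2 = c ^ 2 * (ℓ:ℝ) ^ 2 * β₀ / ν := by
    rw [hμ, div_pow, mul_pow, mul_pow, sq_abs, Real.sq_sqrt hβ₀.le, Real.sq_sqrt hν.le]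
  have hμ1 : 1 ≤ μ := by
    have h0 : 0 ≤ μ := by rw [hμ]; positivity
    have : 1 ≤ μ ^ 2 := by
      rw [hμ2, le_div_iff₀ hν]
      have : 1 ≤ (ℓ:ℝ) ^ 2 := by rw [← sq_abs]; nlinarith
      have h2 : 0 < c ^ 2 * β₀ := by positivity
      nlinarith
    nlinarith
  have hexp : Real.exp (-τ) ≤ Real.exp (-(ν * t)) := Real.exp_le_exp.2 (by linarith)
  have hexp2 : Real.exp (-τ) ^ 2 ≤ Real.exp (-(ν * t)) ^ 2 :=
    pow_le_pow_left₀ (Real.exp_pos _).le hexp 2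
  have hP : 16 * μ ^ 2 ≤ 8 * (β₀ / (2 * ν) * (a * ℓ * Real.exp (-(ν * t))) ^ 2) := by
    have e1 : 16 * μ ^ 2 = 4 * (β₀ / ν * (a ^ 2 * (ℓ:ℝ) ^ 2)) * Real.exp (-τ) ^ 2 := by
      rw [hμ2, hcd, div_pow, mul_pow, sq_abs]; ring
    have e2 : 8 * (β₀ / (2 * ν) * (a * ℓ * Real.exp (-(ν * t))) ^ 2)
        = 4 * (β₀ / ν * (a ^ 2 * (ℓ:ℝ) ^ 2)) * Real.exp (-(ν * t)) ^ 2 := by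
      field_simp; ring
    rw [e1, e2]
    exact mul_le_mul_of_nonneg_left hexp2 (by positivity)
  have key := key_ineq μ _ (le_trans (by nlinarith) hP) u hu hper
  rw [tnormSq_Cop]
  have e3 : c / 8 * |(ℓ:ℝ)| * Real.sqrt β₀ / Real.sqrt ν = μ / 8 := by rw [hμ]; ring
  rw [e3]
  linarith
end

section
/- For every a ∈ ℝ, ν > 0, t ≥ 0, integer ℓ, and every u ∈ H²(𝕋;ℂ), setting Lu = (∂_x² − ℓ²)u + (1/ν) B^ℓ u, one has the identity 2 Re⟨C^ℓ(L u), C^ℓ u⟩ = −2ℓ² ‖C^ℓ u‖² − 2‖C^ℓ(∂_x u)‖² − 2‖C^ℓ u‖² + 2‖B^ℓ u‖². -/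
noncomputable def Bop (a ν t : ℝ) (ℓ : ℤ) (u : ℝ → ℂ) : ℝ → ℂ :=
  fun x => (-Complex.I) * (a : ℂ) * (ℓ : ℂ) * (Real.exp (-(ν * t)) : ℂ) *
    (Real.sin x : ℂ) * u x

/- The operator `L u = (∂ₓ² - ℓ²) u + (1/ν) B^ℓ u`. -/
noncomputable def Lop (a ν t : ℝ) (ℓ : ℤ) (u : ℝ → ℂ) : ℝ → ℂ :=
  fun x => deriv (deriv u) x - (ℓ : ℂ) ^ 2 * u x + (1 / (ν : ℂ)) * Bop a ν t ℓ u x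

/- L² inner product and squared norm on the torus 𝕋 = ℝ/2πℤ. -/
noncomputable def tinner (f g : ℝ → ℂ) : ℂ :=
  ∫ x in (0:ℝ)..(2 * Real.pi), (starRingEnd ℂ) (f x) * g x

/-- the identity
`2 Re⟨C^ℓ(Lu), C^ℓu⟩ = -2ℓ²‖C^ℓu‖² - 2‖C^ℓ(∂ₓu)‖² - 2‖C^ℓu‖² + 2‖B^ℓu‖²`
for `u ∈ H²(𝕋; ℂ)`, where `L u = (∂ₓ² - ℓ²)u + (1/ν) B^ℓ u`. -/
theorem stmt9 (a ν t : ℝ) (hν : 0 < ν) (ht : 0 ≤ t) (ℓ : ℤ) (u : ℝ → ℂ)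
    (hu : ContDiff ℝ 2 u) (hper : Function.Periodic u (2 * Real.pi)) :
    2 * (tinner (Cop a ν t ℓ (Lop a ν t ℓ u)) (Cop a ν t ℓ u)).re =
      -2 * (ℓ : ℝ) ^ 2 * tnormSq (Cop a ν t ℓ u)
        - 2 * tnormSq (Cop a ν t ℓ (deriv u))
        - 2 * tnormSq (Cop a ν t ℓ u)
        + 2 * tnormSq (Bop a ν t ℓ u) := by
  have hd1 : Differentiable ℝ u := hu.differentiable (by norm_num)
  have hu' : ContDiff ℝ 1 (deriv u) := by
    have h := (contDiff_succ_iff_deriv (n := 1) (f := u) (𝕜 := ℝ)).1 (by simpa [one_add_one_eq_two] using hu)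
    exact h.2.2
  have hd2 : Differentiable ℝ (deriv u) := hu'.differentiable (by norm_num)
  have hc0 : Continuous u := hu.continuous
  have hc1 : Continuous (deriv u) := hu'.continuous
  have hc2 : Continuous (deriv (deriv u)) := hu'.continuous_deriv (by norm_num)
  have hper' : ∀ x, deriv u (x + 2 * Real.pi) = deriv u x := by
    intro x
    rw [← deriv_comp_add_const]
    congr 1
    funext y
    exact hper y
  have hre : ∀ (f : ℝ → ℂ) (f' : ℂ) x, HasDerivAt f f' x →
      HasDerivAt (fun y => (f y).re) f'.re x := fun f f' x h =>
    (Complex.reCLM.hasFDerivAt.comp_hasDerivAt x h)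
  have him : ∀ (f : ℝ → ℂ) (f' : ℂ) x, HasDerivAt f f' x →
      HasDerivAt (fun y => (f y).im) f'.im x := fun f f' x h =>
    (Complex.imCLM.hasFDerivAt.comp_hasDerivAt x h)
  set v := deriv u with hv
  set w := deriv v with hw
  let D1 : ℝ → ℝ := fun x => Real.cos x ^ 2 * ((w x).re * (u x).re + (w x).im * (u x).im)
  let N1 : ℝ → ℝ := fun x => Real.cos x ^ 2 * ((u x).re ^ 2 + (u x).im ^ 2)
  let N2 : ℝ → ℝ := fun x => Real.cos x ^ 2 * ((v x).re ^ 2 + (v x).im ^ 2)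
  let N3 : ℝ → ℝ := fun x => Real.sin x ^ 2 * ((u x).re ^ 2 + (u x).im ^ 2)
  have cD1 : Continuous D1 := by fun_prop
  have cN1 : Continuous N1 := by fun_prop
  have cN2 : Continuous N2 := by fun_prop
  have cN3 : Continuous N3 := by fun_prop
  let F : ℝ → ℝ := fun x => Real.cos x ^ 2 * ((v x).re * (u x).re + (v x).im * (u x).im)
    + Real.cos x * Real.sin x * ((u x).re ^ 2 + (u x).im ^ 2)
  have hF : ∀ x, HasDerivAt F (D1 x + N2 x + N1 x - N3 x) x := by
    intro x
    have a1 := hre u _ x (hd1 x).hasDerivAt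
    have a2 := him u _ x (hd1 x).hasDerivAt
    have a3 := hre v _ x (hd2 x).hasDerivAt
    have a4 := him v _ x (hd2 x).hasDerivAt
    have c := Real.hasDerivAt_cos x
    have s := Real.hasDerivAt_sin x
    have := ((c.pow 2).mul ((a3.mul a1).add (a4.mul a2))).add
      ((c.mul s).mul ((a1.pow 2).add (a2.pow 2)))
    refine this.congr_deriv ?_
    simp only [D1, N1, N2, N3, Pi.mul_apply, Pi.add_apply, Pi.pow_apply, ← hv, ← hw]
    push_cast
    ring
  have key : (∫ x in (0:ℝ)..(2 * Real.pi), D1 x) + (∫ x in (0:ℝ)..(2 * Real.pi), N2 x)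
      + (∫ x in (0:ℝ)..(2 * Real.pi), N1 x) - (∫ x in (0:ℝ)..(2 * Real.pi), N3 x) = 0 := by
    have i1 := cD1.intervalIntegrable (μ := MeasureTheory.volume) 0 (2 * Real.pi)
    have i2 := cN2.intervalIntegrable (μ := MeasureTheory.volume) 0 (2 * Real.pi)
    have i3 := cN1.intervalIntegrable (μ := MeasureTheory.volume) 0 (2 * Real.pi)
    have i4 := cN3.intervalIntegrable (μ := MeasureTheory.volume) 0 (2 * Real.pi)
    rw [← intervalIntegral.integral_add i1 i2, ← intervalIntegral.integral_add (i1.add i2) i3,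
      ← intervalIntegral.integral_sub ((i1.add i2).add i3) i4,
      intervalIntegral.integral_eq_sub_of_hasDerivAt (f := F) (fun x _ => hF x)
        (((i1.add i2).add i3).sub i4)]
    have e1 : u (2 * Real.pi) = u 0 := by simpa using hper 0
    have e2 : v (2 * Real.pi) = v 0 := by simpa using hper' 0
    simp [F, e1, e2]
  let K : ℝ := a * ℓ * Real.exp (-(ν * t))
  have hsq : ∀ z : ℂ, ‖z‖ ^ 2 = z.re ^ 2 + z.im ^ 2 := by
    intro z
    rw [← Complex.normSq_eq_norm_sq, Complex.normSq_apply]; ring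
  have hK : ∀ (s : ℝ) (z : ℂ), (-Complex.I) * (a : ℂ) * (ℓ : ℂ) * (Real.exp (-(ν * t)) : ℂ) *
      (s : ℂ) * z = ((K * s : ℝ) : ℂ) * (-Complex.I * z) := by
    intro s z
    simp only [K]
    push_cast
    ring
  have t1 : tnormSq (Cop a ν t ℓ u) = K ^ 2 * ∫ x in (0:ℝ)..(2 * Real.pi), N1 x := by
    rw [tnormSq, ← intervalIntegral.integral_const_mul]
    congr 1; funext x
    simp only [Cop, hK, hsq, N1, Complex.re_ofReal_mul, Complex.im_ofReal_mul]
    simp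
    ring
  have t2 : tnormSq (Cop a ν t ℓ v) = K ^ 2 * ∫ x in (0:ℝ)..(2 * Real.pi), N2 x := by
    rw [tnormSq, ← intervalIntegral.integral_const_mul]
    congr 1; funext x
    simp only [Cop, hK, hsq, N2, Complex.re_ofReal_mul, Complex.im_ofReal_mul]
    simp
    ring
  have t3 : tnormSq (Bop a ν t ℓ u) = K ^ 2 * ∫ x in (0:ℝ)..(2 * Real.pi), N3 x := by
    rw [tnormSq, ← intervalIntegral.integral_const_mul]
    congr 1; funext x
    simp only [Bop, hK, hsq, N3, Complex.re_ofReal_mul, Complex.im_ofReal_mul]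
    simp
    ring
  have t4 : (tinner (Cop a ν t ℓ (Lop a ν t ℓ u)) (Cop a ν t ℓ u)).re
      = K ^ 2 * (∫ x in (0:ℝ)..(2 * Real.pi), D1 x)
        - (ℓ : ℝ) ^ 2 * K ^ 2 * ∫ x in (0:ℝ)..(2 * Real.pi), N1 x := by
    rw [tinner, ← intervalIntegral.integral_const_mul, ← intervalIntegral.integral_const_mul,
      ← intervalIntegral.integral_sub
        ((cD1.intervalIntegrable _ _).const_mul _)
        ((cN1.intervalIntegrable _ _).const_mul _)]
    have hcont : Continuous (fun x => (starRingEnd ℂ) (Cop a ν t ℓ (Lop a ν t ℓ u) x) *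
        Cop a ν t ℓ u x) := by
      unfold Cop Lop Bop
      rw [← hv, ← hw]
      refine Continuous.mul (Complex.continuous_conj.comp ?_) ?_ <;> fun_prop
    have hh := Complex.reCLM.intervalIntegral_comp_comm
      (hcont.intervalIntegrable (μ := MeasureTheory.volume) 0 (2 * Real.pi))
    simp only [Complex.reCLM_apply] at hh
    rw [← hh]
    congr 1; funext x
    have hl : Lop a ν t ℓ u x = w x - (((ℓ : ℝ) ^ 2 : ℝ) : ℂ) * u x
        + ((ν⁻¹ * (K * Real.sin x) : ℝ) : ℂ) * (-Complex.I * u x) := by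
      simp only [Lop, Bop, hK, ← hv, ← hw]
      push_cast
      ring
    simp only [Cop, hK, hl, map_mul, Complex.conj_ofReal, D1, N1]
    generalize Real.sin x = sx
    generalize Real.cos x = cx
    generalize K = k
    simp only [Complex.mul_re, Complex.mul_im, Complex.add_re, Complex.add_im, Complex.sub_re,
      Complex.sub_im, Complex.ofReal_re, Complex.ofReal_im, Complex.conj_re, Complex.conj_im,
      Complex.neg_re, Complex.neg_im, Complex.I_re, Complex.I_im]
    ring
  rw [t1, t2, t3, t4]
  linear_combination 2 * K ^ 2 * key
end

section
/- Let δ ∈ (0, π/4). There exists a constant M₄ > 0, depending only on δ, such that for all real A > 0 and W > 0 and every u ∈ H¹(ℝ;ℂ) with support contained in [−δ, π + δ], one has A ∫_ℝ |u'(x)|² dx + W ∫_ℝ cos²(x) |u(x)|² dx ≥ M₄ √(A W) ∫_ℝ |u(x)|² dx. -/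
open MeasureTheory

lemma aux_sin (y : ℝ) (h0 : 0 ≤ y) (h1 : y ≤ 3 * Real.pi / 4) :
    2 / (3 * Real.pi) * y ≤ Real.sin y := by
  have hp := Real.pi_pos
  rcases le_total y (Real.pi / 2) with h | h
  · refine le_trans ?_ (Real.mul_le_sin h0 h)
    apply mul_le_mul_of_nonneg_right _ h0
    apply div_le_div_of_nonneg_left <;> linarith
  · have h2 := Real.mul_le_sin (x := Real.pi - y) (by linarith) (by linarith)
    rw [Real.sin_pi_sub] at h2
    refine le_trans ?_ h2
    rw [div_mul_eq_mul_div, div_mul_eq_mul_div, div_le_div_iff₀ (by positivity) hp]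
    nlinarith

lemma aux_cos (x : ℝ) (h : |x - Real.pi / 2| ≤ 3 * Real.pi / 4) :
    (2 / (3 * Real.pi)) ^ 2 * (x - Real.pi / 2) ^ 2 ≤ Real.cos x ^ 2 := by
  have h1 := aux_sin _ (abs_nonneg _) h
  have hp := Real.pi_pos
  have h2 : Real.sin |x - Real.pi / 2| ^ 2 = Real.cos x ^ 2 := by
    rcases abs_choice (x - Real.pi / 2) with h | h <;> rw [h] <;>
      simp only [Real.sin_sub_pi_div_two, Real.sin_neg, neg_neg, neg_sq]
  rw [← h2, ← sq_abs (x - Real.pi / 2), ← mul_pow]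
  exact pow_le_pow_left₀ (by positivity) h1 2

/-- for `δ ∈ (0, π/4)` there is `M₄ > 0`, depending only on `δ`,
such that for all `A, W > 0` and every `u ∈ H¹(ℝ;ℂ)` supported in `[-δ, π+δ]`:
`A ∫ |u'|² + W ∫ cos²(x) |u|² ≥ M₄ √(AW) ∫ |u|²`. -/
theorem stmt11 (δ : ℝ) (hδ0 : 0 < δ) (hδ1 : δ < Real.pi / 4) :
    ∃ M₄ : ℝ, 0 < M₄ ∧
      ∀ A W : ℝ, 0 < A → 0 < W →
        ∀ u : ℝ → ℂ, ContDiff ℝ 1 u →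
          tsupport u ⊆ Set.Icc (-δ) (Real.pi + δ) →
          A * (∫ x : ℝ, ‖deriv u x‖ ^ 2) +
              W * (∫ x : ℝ, Real.cos x ^ 2 * ‖u x‖ ^ 2) ≥
            M₄ * Real.sqrt (A * W) * (∫ x : ℝ, ‖u x‖ ^ 2) := by
  have hp := Real.pi_pos
  refine ⟨2 / (3 * Real.pi), by positivity, ?_⟩
  intro A W hA hW u hu hs
  have hc : HasCompactSupport u :=
    HasCompactSupport.of_support_subset_isCompact isCompact_Icc
      ((subset_tsupport u).trans hs)
  have hcd : HasCompactSupport (deriv u) := hc.deriv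
  have hcu : Continuous u := hu.continuous
  have hdu : Continuous (deriv u) := hu.continuous_deriv le_rfl
  have i1 : Integrable (fun x => ‖deriv u x‖ ^ 2) :=
    (by fun_prop : Continuous (fun x => ‖deriv u x‖ ^ 2)).integrable_of_hasCompactSupport
      (hcd.comp_left (g := fun z : ℂ => ‖z‖ ^ 2) (by simp))
  have k2 : HasCompactSupport (fun x => ‖u x‖ ^ 2) :=
    hc.comp_left (g := fun z : ℂ => ‖z‖ ^ 2) (by simp)
  have i2 : Integrable (fun x => ‖u x‖ ^ 2) :=
    (by fun_prop : Continuous (fun x => ‖u x‖ ^ 2)).integrable_of_hasCompactSupport k2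
  have i3 : Integrable (fun x => Real.cos x ^ 2 * ‖u x‖ ^ 2) :=
    (by fun_prop : Continuous
      (fun x => Real.cos x ^ 2 * ‖u x‖ ^ 2)).integrable_of_hasCompactSupport
      (k2.mul_left (f := fun x => Real.cos x ^ 2))
  have i4 : Integrable (fun x => (x - Real.pi / 2) * ‖u x‖ ^ 2) :=
    (by fun_prop : Continuous
      (fun x => (x - Real.pi / 2) * ‖u x‖ ^ 2)).integrable_of_hasCompactSupport
      (k2.mul_left (f := fun x => x - Real.pi / 2))
  have k5 : HasCompactSupport (fun x => 2 * inner ℝ (u x) (deriv u x)) := by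
    refine hc.mono ?_
    intro x hx hux
    apply hx
    simp [hux]
  have i5 : Integrable (fun x => (x - Real.pi / 2) * (2 * inner ℝ (u x) (deriv u x))) :=
    (by fun_prop : Continuous
      (fun x => (x - Real.pi / 2) * (2 * inner ℝ (u x) (deriv u x)))).integrable_of_hasCompactSupport
      (k5.mul_left (f := fun x => x - Real.pi / 2))
  have hz : ∫ x, (‖u x‖ ^ 2 + (x - Real.pi / 2) * (2 * inner ℝ (u x) (deriv u x))) = 0 := by
    refine integral_eq_zero_of_hasDerivAt_of_integrable
      (f := fun x => (x - Real.pi / 2) * ‖u x‖ ^ 2) ?_ (i2.add i5) i4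
    intro x
    have h1 := ((hu.differentiable one_ne_zero) x).hasDerivAt.norm_sq
    have h2 := ((hasDerivAt_id x).sub_const (Real.pi / 2)).mul h1
    rw [one_mul] at h2
    exact h2
  rw [integral_add i2 i5] at hz
  set c := 2 / (3 * Real.pi) with hcdef
  have hc0 : 0 < c := by positivity
  have key : ∫ x, -(c * √(A * W)) * ((x - Real.pi / 2) * (2 * inner ℝ (u x) (deriv u x)))
      ≤ ∫ x, (A * ‖deriv u x‖ ^ 2 + W * (Real.cos x ^ 2 * ‖u x‖ ^ 2)) := by
    refine integral_mono (i5.const_mul _) ((i1.const_mul A).add (i3.const_mul W)) ?_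
    intro x
    by_cases hx : u x = 0
    · simp only [hx]
      simp
      positivity
    · have hm : x ∈ Set.Icc (-δ) (Real.pi + δ) := hs (subset_tsupport u hx)
      have hcos := aux_cos x (by rw [abs_le]; constructor <;> linarith [hm.1, hm.2])
      rw [← hcdef] at hcos
      have hin := abs_real_inner_le_norm (u x) (deriv u x)
      rw [Real.sqrt_mul hA.le]
      have sA := Real.sq_sqrt hA.le
      have sW := Real.sq_sqrt hW.le
      set y := x - Real.pi / 2
      set I := inner ℝ (u x) (deriv u x)
      have h1 : -(y * I) ≤ |y| * (‖u x‖ * ‖deriv u x‖) := by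
        refine (neg_le_abs _).trans ?_
        rw [abs_mul]
        gcongr
      have h2 : W * (c ^ 2 * y ^ 2 * ‖u x‖ ^ 2) ≤ W * (Real.cos x ^ 2 * ‖u x‖ ^ 2) := by
        gcongr
      have h3 := sq_nonneg (√A * ‖deriv u x‖ - √W * (c * |y| * ‖u x‖))
      have h4 : (√A * ‖deriv u x‖ - √W * (c * |y| * ‖u x‖)) ^ 2
        = A * ‖deriv u x‖ ^ 2 + W * (c ^ 2 * y ^ 2 * ‖u x‖ ^ 2)
          - 2 * (c * (√A * √W)) * (|y| * (‖u x‖ * ‖deriv u x‖)) := by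
        rw [← sq_abs y]
        linear_combination ‖deriv u x‖ ^ 2 * sA + (c ^ 2 * |y| ^ 2 * ‖u x‖ ^ 2) * sW
      have h5 := mul_le_mul_of_nonneg_left h1 (by positivity : 0 ≤ 2 * (c * (√A * √W)))
      show -(c * (√A * √W)) * (y * (2 * I)) ≤
        A * ‖deriv u x‖ ^ 2 + W * (Real.cos x ^ 2 * ‖u x‖ ^ 2)
      linarith
  rw [integral_const_mul, integral_add (i1.const_mul A) (i3.const_mul W),
    integral_const_mul, integral_const_mul] at key
  have : ∫ x, ‖u x‖ ^ 2 = -∫ x, (x - Real.pi / 2) * (2 * inner ℝ (u x) (deriv u x)) := by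
    linarith
  rw [this]
  linarith
end

section
/- Fix a ≠ 0 and ν > 0. Let ŵ : [0,∞) × ℤ² → ℂ be differentiable in t and satisfy d/dt ŵ(t)(k,l) = (𝓛̂(t) ŵ(t))(k,l) for all t ≥ 0 and (k,l) ∈ ℤ². For each sign σ ∈ {+1, −1} and integer j ≥ 0 set p_j^σ(t) = ŵ(t)(2j, σ) + ŵ(t)(−2j, σ) and q_j^σ(t) = ŵ(t)(2j+1, σ) − ŵ(t)(−(2j+1), σ). Then ŵ(t)(0, σ) = 0 for all t ≥ 0 and both σ ∈ {+1,−1} if and only if p_j^σ(t) = 0 and q_j^σ(t) = 0 for all t ≥ 0, all j ≥ 0, and both σ ∈ {+1,−1}. -/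
/- Fourier representation of the linearization of the 2D vorticity equation
   about the bar state `a e^{-νt} cos x`, with the convention `1/0 = 0`. -/
noncomputable def Lhat (a ν t : ℝ) (w : ℤ → ℤ → ℂ) (k l : ℤ) : ℂ :=
  -((ν : ℂ) * ((k : ℂ) ^ 2 + (l : ℂ) ^ 2)) * w k l
    - ((l : ℂ) / 2) * (a : ℂ) * (Real.exp (-(ν * t)) : ℂ) *
      ((1 - 1 / (((k : ℂ) - 1) ^ 2 + (l : ℂ) ^ 2)) * w (k - 1) l
        - (1 - 1 / (((k : ℂ) + 1) ^ 2 + (l : ℂ) ^ 2)) * w (k + 1) l)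

theorem aux_step (a ν : ℝ) (ha : a ≠ 0)
    (w : ℝ → ℤ → ℤ → ℂ)
    (hw : ∀ t : ℝ, 0 ≤ t → ∀ k l : ℤ,
      HasDerivAt (fun s : ℝ => w s k l) (Lhat a ν t (w t) k l) t)
    (σ : ℤ) (hσ : σ = 1 ∨ σ = -1) (k : ℤ) (ε : ℂ)
    (h : ∀ t : ℝ, 0 ≤ t → w t k σ + ε * w t (-k) σ = 0) (t : ℝ) (ht : 0 ≤ t) :
    (1 - 1 / (((k : ℂ) - 1) ^ 2 + 1)) * (w t (k - 1) σ - ε * w t (-(k - 1)) σ)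
      = (1 - 1 / (((k : ℂ) + 1) ^ 2 + 1)) * (w t (k + 1) σ - ε * w t (-(k + 1)) σ) := by
  have hd : HasDerivAt (fun s : ℝ => w s k σ + ε * w s (-k) σ)
      (Lhat a ν t (w t) k σ + ε * Lhat a ν t (w t) (-k) σ) t :=
    (hw t ht k σ).add ((hw t ht (-k) σ).const_mul ε)
  have h0 : HasDerivWithinAt (fun s : ℝ => w s k σ + ε * w s (-k) σ) 0 (Set.Ici 0) t :=
    (hasDerivWithinAt_const t (Set.Ici 0) (0 : ℂ)).congr (fun s hs => h s hs) (h t ht)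
  have he := ((uniqueDiffOn_Ici (0 : ℝ)) t ht).eq_deriv _ hd.hasDerivWithinAt h0
  have hs2 : (σ : ℂ) ^ 2 = 1 := by rcases hσ with rfl | rfl <;> norm_num
  have hs0 : (σ : ℂ) ≠ 0 := by rcases hσ with rfl | rfl <;> norm_num
  have ha' : (a : ℂ) ≠ 0 := by exact_mod_cast ha
  have hE : (Real.exp (-(ν * t)) : ℂ) ≠ 0 := by exact_mod_cast (Real.exp_pos _).ne'
  unfold Lhat at he
  have e1 : -k - 1 = -(k + 1) := by ring
  have e2 : -k + 1 = -(k - 1) := by ring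
  rw [e1, e2, hs2] at he
  push_cast at he
  have e3 : (-(k : ℂ) - 1) ^ 2 = ((k : ℂ) + 1) ^ 2 := by ring
  have e4 : (-(k : ℂ) + 1) ^ 2 = ((k : ℂ) - 1) ^ 2 := by ring
  have hE' : Complex.exp (-((ν : ℂ) * t)) ≠ 0 := Complex.exp_ne_zero _
  rw [e3, e4] at he
  have hk := h t ht
  generalize (1 - 1 / (((k : ℂ) - 1) ^ 2 + 1)) = B at he ⊢
  generalize (1 - 1 / (((k : ℂ) + 1) ^ 2 + 1)) = C at he ⊢
  have hc : (σ : ℂ) / 2 * a * Complex.exp (-((ν : ℂ) * t)) ≠ 0 :=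
    mul_ne_zero (mul_ne_zero (div_ne_zero hs0 two_ne_zero) ha') hE'
  apply mul_left_cancel₀ hc
  linear_combination (-1 : ℂ) * he - (ν : ℂ) * ((k : ℂ) ^ 2 + 1) * hk

theorem aux_ne (n : ℕ) : (1 - 1 / ((((n : ℤ) : ℂ) + 1) ^ 2 + 1)) ≠ 0 := by
  have h : (1 - 1 / (((n : ℝ) + 1) ^ 2 + 1)) ≠ 0 := by
    have : (0 : ℝ) < ((n : ℝ) + 1) ^ 2 + 1 := by positivity
    field_simp
    ring_nf
    positivity
  intro hc
  apply h
  apply Complex.ofReal_injective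
  push_cast at hc ⊢
  exact hc

theorem aux_main (a ν : ℝ) (ha : a ≠ 0)
    (w : ℝ → ℤ → ℤ → ℂ)
    (hw : ∀ t : ℝ, 0 ≤ t → ∀ k l : ℤ,
      HasDerivAt (fun s : ℝ => w s k l) (Lhat a ν t (w t) k l) t)
    (σ : ℤ) (hσ : σ = 1 ∨ σ = -1) (h : ∀ t : ℝ, 0 ≤ t → w t 0 σ = 0) (n : ℕ) :
    (∀ t : ℝ, 0 ≤ t → w t (n : ℤ) σ + (-1) ^ n * w t (-(n : ℤ)) σ = 0) ∧
    (∀ t : ℝ, 0 ≤ t → w t ((n : ℤ) + 1) σ + (-1) ^ (n + 1) * w t (-((n : ℤ) + 1)) σ = 0) := by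
  induction n with
  | zero =>
    have h0 : ∀ t : ℝ, 0 ≤ t → w t 0 σ + 1 * w t (-0) σ = 0 := by
      intro t ht
      simp [h t ht]
    refine ⟨by simpa using h0, fun t ht => ?_⟩
    have := aux_step a ν ha w hw σ hσ 0 1 h0 t ht
    norm_num at this ⊢
    linear_combination (-1 / 2 : ℂ) * this
  | succ n ih =>
    obtain ⟨h1, h2⟩ := ih
    refine ⟨by exact_mod_cast h2, fun t ht => ?_⟩
    have := aux_step a ν ha w hw σ hσ ((n : ℤ) + 1) ((-1) ^ (n + 1)) h2 t ht
    have e : (n : ℤ) + 1 - 1 = n := by ring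
    have hz : w t (n : ℤ) σ - (-1) ^ (n + 1) * w t (-(n : ℤ)) σ = 0 := by
      rw [← h1 t ht]; ring
    rw [e, hz, mul_zero] at this
    have hne := aux_ne (n + 1)
    push_cast at hne this ⊢
    have := (mul_eq_zero.mp this.symm).resolve_left hne
    rw [← this]; ring

/-- for a solution `ŵ` of `d/dt ŵ = 𝓛̂(t)ŵ`, the mode
`ŵ(t)(0,σ)` (σ = ±1) vanishes for all `t ≥ 0` if and only if all the
combinations `p_j^σ = ŵ(2j,σ) + ŵ(-2j,σ)` and
`q_j^σ = ŵ(2j+1,σ) - ŵ(-(2j+1),σ)` vanish for all `t ≥ 0` and `j ≥ 0`. -/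
theorem stmt15 (a ν : ℝ) (ha : a ≠ 0) (hν : 0 < ν)
    (w : ℝ → ℤ → ℤ → ℂ)
    (hw : ∀ t : ℝ, 0 ≤ t → ∀ k l : ℤ,
      HasDerivAt (fun s : ℝ => w s k l) (Lhat a ν t (w t) k l) t) :
    (∀ t : ℝ, 0 ≤ t → ∀ σ : ℤ, σ = 1 ∨ σ = -1 → w t 0 σ = 0) ↔
    (∀ t : ℝ, 0 ≤ t → ∀ σ : ℤ, σ = 1 ∨ σ = -1 → ∀ j : ℕ,
      w t (2 * (j : ℤ)) σ + w t (-(2 * (j : ℤ))) σ = 0 ∧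
      w t (2 * (j : ℤ) + 1) σ - w t (-(2 * (j : ℤ) + 1)) σ = 0) := by
  constructor
  · intro h t ht σ hσ j
    have hm := aux_main a ν ha w hw σ hσ (fun t ht => h t ht σ hσ) (2 * j)
    have h1 := hm.1 t ht
    have h2 := hm.2 t ht
    rw [pow_succ] at h2
    simp only [pow_mul] at h1 h2
    push_cast at h1 h2
    norm_num at h1 h2
    refine ⟨h1, ?_⟩
    rw [← h2]
    ring_nf
  · intro h t ht σ hσ
    have := (h t ht σ hσ 0).1
    simp at this
    exact this
end

section
/- Fix a ∈ ℝ and ν > 0. Let ŵ : [0,∞) × ℤ² → ℂ be differentiable in t and satisfy d/dt ŵ(t)(k,l) = (𝓛̂(t) ŵ(t))(k,l) for all t ≥ 0 and (k,l) ∈ ℤ². For each sign σ ∈ {+1, −1} and integer j ≥ 0 set p_j^σ(t) = ŵ(t)(2j, σ) + ŵ(t)(−2j, σ) and q_j^σ(t) = ŵ(t)(2j+1, σ) − ŵ(t)(−(2j+1), σ). Then the following closed system of ODEs holds: d/dt p_0^σ = −ν p_0^σ + σ (a/2) e^{−νt} q_0^σ; for j ≥ 1, d/dt p_j^σ = −ν(4j²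 + 1) p_j^σ − σ (a/2) e^{−νt} [ (1 − 1/((2j−1)² + 1)) q_{j−1}^σ − (1 − 1/((2j+1)² + 1)) q_j^σ ]; and for j ≥ 0, d/dt q_j^σ = −ν((2j+1)² + 1) q_j^σ − σ (a/2) e^{−νt} [ (1 − 1/((2j)² + 1)) p_j^σ − (1 − 1/((2j+2)² + 1)) p_{j+1}^σ ]. -/
/- `p_j^σ(t) = ŵ(t)(2j,σ) + ŵ(t)(-2j,σ)`. -/
def pc (w : ℝ → ℤ → ℤ → ℂ) (σ : ℤ) (j : ℕ) (t : ℝ) : ℂ :=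
  w t (2 * (j : ℤ)) σ + w t (-(2 * (j : ℤ))) σ

/- `q_j^σ(t) = ŵ(t)(2j+1,σ) - ŵ(t)(-(2j+1),σ)`. -/
def qc (w : ℝ → ℤ → ℤ → ℂ) (σ : ℤ) (j : ℕ) (t : ℝ) : ℂ :=
  w t (2 * (j : ℤ) + 1) σ - w t (-(2 * (j : ℤ) + 1)) σ

/-- for a solution `ŵ` of `d/dt ŵ = 𝓛̂(t)ŵ`, the quantities
`p_j^σ, q_j^σ` satisfy the stated closed tridiagonal system of ODEs. -/
theorem stmt16 (a ν : ℝ) (hν : 0 < ν) (w : ℝ → ℤ → ℤ → ℂ)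
    (hw : ∀ t : ℝ, 0 ≤ t → ∀ k l : ℤ,
      HasDerivAt (fun s : ℝ => w s k l) (Lhat a ν t (w t) k l) t) :
    ∀ t : ℝ, 0 ≤ t → ∀ σ : ℤ, σ = 1 ∨ σ = -1 →
      HasDerivAt (pc w σ 0)
        (-(ν : ℂ) * pc w σ 0 t
          + (σ : ℂ) * ((a : ℂ) / 2) * (Real.exp (-(ν * t)) : ℂ) * qc w σ 0 t) t ∧
      (∀ j : ℕ, 1 ≤ j →
        HasDerivAt (pc w σ j)
          (-((ν * (4 * (j : ℝ) ^ 2 + 1) : ℝ) : ℂ) * pc w σ j t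
            - (σ : ℂ) * ((a : ℂ) / 2) * (Real.exp (-(ν * t)) : ℂ) *
              (((1 - 1 / ((2 * (j : ℝ) - 1) ^ 2 + 1) : ℝ) : ℂ) * qc w σ (j - 1) t
                - ((1 - 1 / ((2 * (j : ℝ) + 1) ^ 2 + 1) : ℝ) : ℂ) * qc w σ j t)) t) ∧
      (∀ j : ℕ,
        HasDerivAt (qc w σ j)
          (-((ν * ((2 * (j : ℝ) + 1) ^ 2 + 1) : ℝ) : ℂ) * qc w σ j t
            - (σ : ℂ) * ((a : ℂ) / 2) * (Real.exp (-(ν * t)) : ℂ) *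
              (((1 - 1 / ((2 * (j : ℝ)) ^ 2 + 1) : ℝ) : ℂ) * pc w σ j t
                - ((1 - 1 / ((2 * (j : ℝ) + 2) ^ 2 + 1) : ℝ) : ℂ) * pc w σ (j + 1) t)) t) := by
  intro t ht σ hσ
  have hs : (σ : ℂ) ^ 2 = 1 := by rcases hσ with h | h <;> simp [h]
  refine ⟨?_, ?_, ?_⟩
  · have h := (hw t ht (2 * ((0 : ℕ) : ℤ)) σ).add (hw t ht (-(2 * ((0 : ℕ) : ℤ))) σ)
    refine HasDerivAt.congr_deriv (f := pc w σ 0) h ?_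
    simp only [Lhat, pc, qc, hs]
    norm_num
    ring
  · intro j hj
    obtain ⟨m, rfl⟩ : ∃ m, j = m + 1 := ⟨j - 1, by omega⟩
    have h := (hw t ht (2 * ((m + 1 : ℕ) : ℤ)) σ).add (hw t ht (-(2 * ((m + 1 : ℕ) : ℤ))) σ)
    refine HasDerivAt.congr_deriv (f := pc w σ (m + 1)) h ?_
    simp only [Lhat, pc, qc, hs, Nat.add_sub_cancel]
    have e1 : 2 * ((m + 1 : ℕ) : ℤ) - 1 = 2 * (m : ℤ) + 1 := by push_cast; ring
    have e2 : -(2 * ((m + 1 : ℕ) : ℤ)) - 1 = -(2 * ((m + 1 : ℕ) : ℤ) + 1) := by ring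
    have e3 : -(2 * ((m + 1 : ℕ) : ℤ)) + 1 = -(2 * (m : ℤ) + 1) := by push_cast; ring
    rw [e1, e2, e3]
    generalize w t (2 * ((m + 1 : ℕ) : ℤ)) σ = A
    generalize w t (-(2 * ((m + 1 : ℕ) : ℤ))) σ = B
    generalize w t (2 * ((m + 1 : ℕ) : ℤ) + 1) σ = C
    generalize w t (-(2 * ((m + 1 : ℕ) : ℤ) + 1)) σ = D
    push_cast
    have d1 : (-(2 * ((m : ℂ) + 1)) - 1) ^ 2 = (2 * ((m : ℂ) + 1) + 1) ^ 2 := by ring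
    have d2 : (-(2 * ((m : ℂ) + 1)) + 1) ^ 2 = (2 * ((m : ℂ) + 1) - 1) ^ 2 := by ring
    rw [d1, d2]
    generalize 1 / ((2 * ((m : ℂ) + 1) + 1) ^ 2 + 1) = X
    generalize 1 / ((2 * ((m : ℂ) + 1) - 1) ^ 2 + 1) = Y
    ring
  · intro m
    have h := (hw t ht (2 * (m : ℤ) + 1) σ).sub (hw t ht (-(2 * (m : ℤ) + 1)) σ)
    refine HasDerivAt.congr_deriv (f := qc w σ m) h ?_
    simp only [Lhat, pc, qc, hs]
    have e1 : 2 * (m : ℤ) + 1 - 1 = 2 * (m : ℤ) := by ring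
    have e2 : -(2 * (m : ℤ) + 1) - 1 = -(2 * ((m + 1 : ℕ) : ℤ)) := by push_cast; ring
    have e3 : -(2 * (m : ℤ) + 1) + 1 = -(2 * (m : ℤ)) := by ring
    have e4 : 2 * (m : ℤ) + 1 + 1 = 2 * ((m + 1 : ℕ) : ℤ) := by push_cast; ring
    rw [e1, e2, e3, e4]
    generalize w t (2 * ((m + 1 : ℕ) : ℤ)) σ = A
    generalize w t (-(2 * ((m + 1 : ℕ) : ℤ))) σ = B
    push_cast
    have d1 : (-(2 * (m : ℂ) + 1) - 1) ^ 2 = (2 * (m : ℂ) + 2) ^ 2 := by ring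
    have d2 : (-(2 * (m : ℂ) + 1) + 1) ^ 2 = (2 * (m : ℂ)) ^ 2 := by ring
    have d3 : (2 * (m : ℂ) + 1 - 1) ^ 2 = (2 * (m : ℂ)) ^ 2 := by ring
    have d4 : (2 * (m : ℂ) + 1 + 1) ^ 2 = (2 * (m : ℂ) + 2) ^ 2 := by ring
    rw [d1, d2, d3, d4]
    generalize 1 / ((2 * (m : ℂ) + 2) ^ 2 + 1) = X
    generalize 1 / ((2 * (m : ℂ)) ^ 2 + 1) = Y
    ring
end
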